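/- Let F be a monic real polynomial with exactly p positive real roots counted with multiplicity. Then there exists a nonzero real polynomial K such that the product F·K has exactly p sign variations in its coefficient sequence (so Descartes's bound is attained with equality and the even defect ν(FK) is zero). -/

import Mathlib

open Polynomial

/-- Number of sign variations of a finite real sequence: the number of sign
changes between consecutive nonzero terms (zeros are ignored). -/
noncomputable def signVarList (l : List ℝ) : ℕ :=
  let l' := l.filter (fun x => decide (x ≠ 0))
  (l'.zip l'.tail).countP (fun p => decide (p.1 * p.2 < 0))

/-- Number of sign variations of the coefficient sequence of a real polynomial. -/
noncomputable def signVar (P : Polynomial ℝ) : ℕ :=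
  signVarList ((List.range (P.natDegree + 1)).map P.coeff)

/-- Sign variations of `L` with a preceding entry `x`. -/
noncomputable def svAux : ℝ → List ℝ → ℕ
  | _, [] => 0
  | x, y :: L => if y = 0 then svAux x L else (if x * y < 0 then 1 else 0) + svAux y L

lemma svAux_eq (L : List ℝ) : ∀ x : ℝ, svAux x L =
    (List.zip (x :: L.filter (fun x => decide (x ≠ 0)))
      (L.filter (fun x => decide (x ≠ 0)))).countP (fun p => decide (p.1 * p.2 < 0)) := by
  induction L with
  | nil => intro x; simp [svAux]
  | cons y L ih =>
    intro x
    by_cases hy : y = 0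
    · simp [svAux, hy, ih]
    · simp only [svAux, hy, if_false, ih]
      simp [hy, List.countP_cons, add_comm]

lemma signVarList_eq (L : List ℝ) : signVarList L = svAux 0 L := by
  rw [svAux_eq]
  unfold signVarList
  cases h : L.filter (fun x => decide (x ≠ 0)) with
  | nil => simp
  | cons y T => simp [List.countP_cons]

lemma svAux_block_pos (s : ℝ) (L : List ℝ) (B : List ℝ) :
    ∀ x : ℝ, 0 < s * x → (∀ y ∈ B, 0 ≤ s * y) →
    ∃ x', 0 < s * x' ∧ svAux x (B ++ L) = svAux x' L := by
  induction B with
  | nil => intro x hx _; exact ⟨x, hx, rfl⟩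
  | cons y B ih =>
    intro x hx hB
    by_cases hy : y = 0
    · obtain ⟨x', h1, h2⟩ := ih x hx (fun z hz => hB z (by simp [hz]))
      exact ⟨x', h1, by simpa [svAux, hy] using h2⟩
    · have hs : s ≠ 0 := by rintro rfl; simp at hx
      have hsy : 0 < s * y := lt_of_le_of_ne (hB y (by simp)) (mul_ne_zero hs hy).symm
      obtain ⟨x', h1, h2⟩ := ih y hsy (fun z hz => hB z (by simp [hz]))
      refine ⟨x', h1, ?_⟩
      have : ¬ x * y < 0 := by
        intro h
        have h3 : 0 < (s * x) * (s * y) := mul_pos hx hsy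
        have h4 : 0 < s * s := mul_self_pos.mpr hs
        nlinarith
      simp [svAux, hy, this, h2]

lemma svAux_block (s : ℝ) (hs : s ≠ 0) (L : List ℝ) (B : List ℝ) :
    ∀ x : ℝ, (∀ y ∈ B, 0 ≤ s * y) → (∃ y ∈ B, y ≠ 0) →
    ∃ x', 0 < s * x' ∧ svAux x (B ++ L) = (if s * x < 0 then 1 else 0) + svAux x' L := by
  induction B with
  | nil => intro x _ h; simp at h
  | cons y B ih =>
    intro x hB hne
    by_cases hy : y = 0
    · obtain ⟨x', h1, h2⟩ := ih x (fun z hz => hB z (by simp [hz])) (by simpa [hy] using hne)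
      exact ⟨x', h1, by simpa [svAux, hy] using h2⟩
    · have hsy : 0 < s * y := lt_of_le_of_ne (hB y (by simp)) (mul_ne_zero hs hy).symm
      obtain ⟨x', h1, h2⟩ := svAux_block_pos s L B y hsy (fun z hz => hB z (by simp [hz]))
      refine ⟨x', h1, ?_⟩
      have : x * y < 0 ↔ s * x < 0 := by
        have h4 : 0 < s * s := mul_self_pos.mpr hs
        have h5 : (s * x) * (s * y) = (s * s) * (x * y) := by ring
        constructor
        · intro h
          by_contra h6
          have : 0 ≤ (s * x) * (s * y) := mul_nonneg (not_lt.mp h6) hsy.le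
          nlinarith
        · intro h
          have : (s * x) * (s * y) < 0 := mul_neg_of_neg_of_pos h hsy
          by_contra h6
          nlinarith [mul_nonneg h4.le (not_lt.mp h6)]
      simp [svAux, hy, this, h2]

lemma svAux_blocks (N : ℕ) (g : ℕ → ℝ) (hg : ∀ j, 0 ≤ g j) (hg' : ∃ j < N, g j ≠ 0) (p : ℕ) :
    ∀ (c f : ℕ → ℝ) (x : ℝ), (∀ k ≤ p, c k ≠ 0) → (∀ k < p, c k * c (k + 1) < 0) →
    (∀ k ≤ p, ∀ j < N, f (k * N + j) = g j * c k) →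
    svAux x ((List.range ((p + 1) * N)).map f) = (if c 0 * x < 0 then 1 else 0) + p := by
  obtain ⟨j, hj, hgj⟩ := hg'
  induction p with
  | zero =>
    intro c f x hc _ hf
    have := svAux_block (c 0) (hc 0 le_rfl) [] ((List.range N).map f) x ?_ ?_
    · obtain ⟨x', _, h⟩ := this
      simpa [svAux] using h
    · intro y hy
      simp only [List.mem_map, List.mem_range] at hy
      obtain ⟨i, hi, rfl⟩ := hy
      have := hf 0 le_rfl i hi
      simp only [zero_mul, zero_add] at this
      rw [this]
      nlinarith [mul_nonneg (hg i) (mul_self_nonneg (c 0))]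
    · refine ⟨f j, by simp only [List.mem_map, List.mem_range]; exact ⟨j, hj, rfl⟩, ?_⟩
      have := hf 0 le_rfl j hj
      simp only [zero_mul, zero_add] at this
      rw [this]
      exact mul_ne_zero hgj (hc 0 le_rfl)
  | succ p ih =>
    intro c f x hc hc' hf
    have e : (p + 1 + 1) * N = N + (p + 1) * N := by ring
    rw [e, List.range_add, List.map_append, List.map_map]
    have := svAux_block (c 0) (hc 0 (by simp)) (List.map (f ∘ fun x => N + x) (List.range ((p + 1) * N)))
      ((List.range N).map f) x ?_ ?_
    · obtain ⟨x', h1, h⟩ := this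
      rw [h, ih (fun k => c (k + 1)) _ x' (fun k hk => hc _ (by omega)) (fun k hk => hc' _ (by omega)) ?_]
      · have h0 := hc' 0 (by omega)
        have : c (0 + 1) * x' < 0 := by
          by_contra h6
          have h7 : (c 0 * c (0 + 1)) * (c 0 * x') < 0 := mul_neg_of_neg_of_pos h0 h1
          nlinarith [mul_nonneg (mul_self_nonneg (c 0)) (not_lt.mp h6)]
        rw [if_pos this]
        ring
      · intro k hk i hi
        have := hf (k + 1) (by omega) i hi
        rw [← this]
        simp only [Function.comp]
        congr 1
        ring
    · intro y hy
      simp only [List.mem_map, List.mem_range] at hy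
      obtain ⟨i, hi, rfl⟩ := hy
      have := hf 0 (by simp) i hi
      simp only [zero_mul, zero_add] at this
      rw [this]
      nlinarith [mul_nonneg (hg i) (mul_self_nonneg (c 0))]
    · refine ⟨f j, by simp only [List.mem_map, List.mem_range]; exact ⟨j, hj, rfl⟩, ?_⟩
      have := hf 0 (by simp) j hj
      simp only [zero_mul, zero_add] at this
      rw [this]
      exact mul_ne_zero hgj (hc 0 (by simp))

lemma signVar_eq (P : ℝ[X]) (M : ℕ) (hM : P.natDegree < M) :
    signVar P = svAux 0 ((List.range M).map P.coeff) := by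
  rw [← signVarList_eq]
  obtain ⟨m, rfl⟩ := Nat.exists_eq_add_of_le (Nat.succ_le_of_lt hM)
  have : ((List.range (P.natDegree.succ + m)).map P.coeff).filter (fun x => decide (x ≠ 0))
      = ((List.range (P.natDegree + 1)).map P.coeff).filter (fun x => decide (x ≠ 0)) := by
    rw [List.range_add, List.map_append, List.filter_append]
    refine (congrArg _ (List.filter_eq_nil_iff.mpr ?_)).trans (List.append_nil _)
    intro a ha
    simp only [List.map_map, List.mem_map, List.mem_range] at ha
    obtain ⟨i, hi, rfl⟩ := ha
    simp only [Function.comp]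
    have h0 : P.coeff (P.natDegree.succ + i) = 0 := coeff_eq_zero_of_natDegree_lt (by omega)
    simp [h0]
  unfold signVar signVarList
  rw [this]

lemma coeff_alt (S : Multiset ℝ) (hS : ∀ b ∈ S, 0 < b) :
    ∀ k ≤ Multiset.card S,
      0 < (-1 : ℝ) ^ (k + Multiset.card S) * ((S.map (fun a => X - C a)).prod).coeff k := by
  induction S using Multiset.induction_on with
  | empty => intro k hk; simp at hk; subst hk; simp
  | cons b S ih =>
    have hb := hS b (by simp)
    have ih := ih (fun b hb => hS b (by simp [hb]))
    have hdeg : ((S.map (fun a => X - C a)).prod).natDegree = Multiset.card S :=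
      natDegree_multiset_prod_X_sub_C_eq_card S
    intro k hk
    simp only [Multiset.map_cons, Multiset.prod_cons, Multiset.card_cons] at hk ⊢
    cases k with
    | zero =>
      have := ih 0 (by simp)
      simp only [sub_mul, coeff_sub, coeff_C_mul, mul_coeff_zero, coeff_X_zero, zero_mul, zero_sub]
      have h := mul_pos hb this
      refine lt_of_lt_of_eq h ?_
      simp only [coeff_C_zero]
      ring
    | succ k =>
      rw [sub_mul, coeff_sub, coeff_X_mul, coeff_C_mul]
      have h1 := ih k (by omega)
      have h2 : 0 ≤ b * ((-1 : ℝ) ^ (k + 1 + Multiset.card S) *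
          ((S.map (fun a => X - C a)).prod).coeff (k + 1)) := by
        by_cases h : k + 1 ≤ Multiset.card S
        · exact (mul_pos hb (ih _ h)).le
        · rw [coeff_eq_zero_of_natDegree_lt (by omega)]; simp
      have h3 := add_pos_of_pos_of_nonneg h1 h2
      refine lt_of_lt_of_eq h3 ?_
      ring

lemma coeff_mul_expand (G c : ℝ[X]) (N : ℕ) (hN : G.natDegree < N) (k j : ℕ) (hj : j < N) :
    (G * expand ℝ N c).coeff (k * N + j) = G.coeff j * c.coeff k := by
  have hN0 : 0 < N := by omega
  rw [coeff_mul, Finset.sum_eq_single (j, k * N)]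
  · simp [coeff_expand hN0, hN0]
  · rintro ⟨i, m⟩ h hne
    replace h : i + m = k * N + j := Finset.HasAntidiagonal.mem_antidiagonal.mp h
    by_cases hi : i < N
    · rw [coeff_expand hN0, if_neg, mul_zero]
      rintro ⟨t, rfl⟩
      apply hne
      have h1 : (i + N * t) % N = (k * N + j) % N := by rw [h]
      rw [Nat.add_mul_mod_self_left, Nat.mod_eq_of_lt hi, mul_comm k N, Nat.mul_add_mod, Nat.mod_eq_of_lt hj] at h1
      subst h1
      simp only [Prod.mk.injEq, true_and]
      clear hne
      omega
    · rw [coeff_eq_zero_of_natDegree_lt (by omega), zero_mul]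
  · intro h
    exact absurd (by simp [add_comm]) h

lemma quad (n : ℕ) : ∀ b c : ℝ, 0 < c → 4 * c < (4 * c - b ^ 2) * 2 ^ n →
    ∃ K : ℝ[X], K ≠ 0 ∧ ∀ i, 0 ≤ ((X ^ 2 - C b * X + C c) * K).coeff i := by
  have base : ∀ b c : ℝ, b ≤ 0 → 0 < c → ∀ i, 0 ≤ (X ^ 2 - C b * X + C c : ℝ[X]).coeff i := by
    intro b c hb hc i
    simp only [coeff_add, coeff_sub, coeff_X_pow, coeff_C_mul, coeff_X, coeff_C]
    split_ifs <;> simp <;> linarith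
  induction n with
  | zero => intro b c hc h; nlinarith [sq_nonneg b]
  | succ n ih =>
    intro b c hc h
    by_cases hb : b ≤ 0
    · exact ⟨1, one_ne_zero, by simpa using base b c hb hc⟩
    have key : (X ^ 2 - C b * X + C c : ℝ[X]) * (X ^ 2 + C b * X + C c) =
        expand ℝ 2 (X ^ 2 - C (b ^ 2 - 2 * c) * X + C (c ^ 2)) := by
      simp only [map_add, map_sub, map_mul, map_pow, expand_X, expand_C, map_ofNat]
      ring
    have hne : (X ^ 2 + C b * X + C c : ℝ[X]) ≠ 0 := by
      intro h0
      have := congrArg (fun q => q.coeff 0) h0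
      simp at this
      exact hc.ne' this
    have : ∃ K : ℝ[X], K ≠ 0 ∧
        ∀ i, 0 ≤ ((X ^ 2 - C (b ^ 2 - 2 * c) * X + C (c ^ 2)) * K).coeff i := by
      by_cases hb' : b ^ 2 - 2 * c ≤ 0
      · exact ⟨1, one_ne_zero, by rw [mul_one]; exact base (b ^ 2 - 2 * c) (c ^ 2) hb' (by positivity)⟩
      · apply ih _ _ (by positivity)
        have e : 4 * c ^ 2 - (b ^ 2 - 2 * c) ^ 2 = b ^ 2 * (4 * c - b ^ 2) := by ring
        rw [e]
        rw [pow_succ 2 n, ← mul_assoc] at h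
        have h1 : 0 < (4 * c - b ^ 2) * 2 ^ n := by linarith
        have h2 := mul_pos (sub_pos.mpr (not_le.mp hb')) h1
        have h3 := mul_pos hc (sub_pos.mpr h)
        nlinarith
    obtain ⟨K, hK, hK'⟩ := this
    refine ⟨(X ^ 2 + C b * X + C c) * expand ℝ 2 K,
      mul_ne_zero hne ((expand_ne_zero (by norm_num)).mpr hK), fun i => ?_⟩
    rw [← mul_assoc, key, ← map_mul, coeff_expand (by norm_num)]
    split_ifs
    · exact hK' _
    · exact le_rfl

lemma irred_case (q : ℝ[X]) (hq : Irreducible q) (h : ∀ x : ℝ, 0 < x → q.eval x ≠ 0) :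
    ∃ K : ℝ[X], K ≠ 0 ∧ ∀ i, 0 ≤ (q * K).coeff i := by
  have hd := hq.natDegree_le_two
  have hpos := hq.natDegree_pos
  have h12 : q.natDegree = 1 ∨ q.natDegree = 2 := by omega
  rcases h12 with h1 | h2
  · obtain ⟨a, ha, b, hab⟩ := natDegree_eq_one.mp h1
    subst hab
    refine ⟨C a, by simpa using ha, fun i => ?_⟩
    have hb : 0 ≤ b * a := by
      by_contra hb
      push Not at hb
      refine h (-b / a) ?_ ?_
      · have : -b / a = -(b * a) / (a * a) := by field_simp
        rw [this]
        exact div_pos (by linarith) (mul_self_pos.mpr ha)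
      · simp; field_simp; ring
    rw [coeff_mul_C]
    simp only [coeff_add, coeff_C_mul, coeff_X, coeff_C]
    split_ifs <;> simp <;> nlinarith [mul_self_nonneg a]
  · set a := q.coeff 2 with haa
    set b := q.coeff 1
    set c := q.coeff 0
    have ha : a ≠ 0 := by
      have : q.leadingCoeff ≠ 0 := leadingCoeff_ne_zero.mpr hq.ne_zero
      rwa [leadingCoeff, h2] at this
    have hq2 : q = C a * X ^ 2 + C b * X + C c := by
      exact eq_quadratic_of_degree_le_two (natDegree_le_iff_degree_le.mp hd)
    have hnr : ∀ x, q.eval x ≠ 0 := by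
      intro x hx
      have := degree_eq_one_of_irreducible_of_root hq hx
      rw [degree_eq_natDegree hq.ne_zero, h2] at this
      norm_cast at this
    have hdisc : b ^ 2 < 4 * a * c := by
      by_contra hdisc
      push Not at hdisc
      apply hnr ((-b + Real.sqrt (b ^ 2 - 4 * a * c)) / (2 * a))
      rw [hq2]
      simp only [eval_add, eval_mul, eval_C, eval_pow, eval_X]
      have hs := Real.sq_sqrt (show 0 ≤ b ^ 2 - 4 * a * c by linarith)
      set t := Real.sqrt (b ^ 2 - 4 * a * c)
      field_simp
      linear_combination hs
    have hc' : 0 < c / a := by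
      have : c / a = (4 * a * c) / (4 * (a * a)) := by field_simp
      rw [this]
      exact div_pos (lt_of_le_of_lt (sq_nonneg b) hdisc) (by have := mul_self_pos.mpr ha; linarith)
    have hd' : 0 < 4 * (c / a) - (-b / a) ^ 2 := by
      have : 4 * (c / a) - (-b / a) ^ 2 = (4 * a * c - b ^ 2) / (a * a) := by field_simp
      rw [this]
      exact div_pos (by linarith) (mul_self_pos.mpr ha)
    obtain ⟨n, hn⟩ := pow_unbounded_of_one_lt (4 * (c / a) / (4 * (c / a) - (-b / a) ^ 2))
      (one_lt_two)
    rw [div_lt_iff₀ hd', mul_comm (2 ^ n)] at hn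
    obtain ⟨K, hK, hK'⟩ := quad n _ _ hc' hn
    refine ⟨C a⁻¹ * K, mul_ne_zero (by simpa using ha) hK, fun i => ?_⟩
    convert hK' i using 2
    rw [← mul_assoc]
    congr 1
    rw [hq2]
    have e : (C a * C a⁻¹ : ℝ[X]) = 1 := by rw [← C_mul, mul_inv_cancel₀ ha, C_1]
    simp only [div_eq_mul_inv, C_mul, C_neg]
    linear_combination (X ^ 2) * e

lemma nonneg_mul (P Q : ℝ[X]) (hP : ∀ i, 0 ≤ P.coeff i) (hQ : ∀ i, 0 ≤ Q.coeff i) (i : ℕ) :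
    0 ≤ (P * Q).coeff i := by
  rw [coeff_mul]
  exact Finset.sum_nonneg (fun x _ => mul_nonneg (hP _) (hQ _))

lemma exists_nonneg (q : ℝ[X]) : q ≠ 0 → (∀ x : ℝ, 0 < x → q.eval x ≠ 0) →
    ∃ K : ℝ[X], K ≠ 0 ∧ ∀ i, 0 ≤ (q * K).coeff i := by
  induction q using WfDvdMonoid.induction_on_irreducible with
  | zero => intro h; exact absurd rfl h
  | unit u hu =>
    intro _ _
    obtain ⟨v, hv⟩ := hu.exists_right_inv
    refine ⟨v, right_ne_zero_of_mul (hv ▸ one_ne_zero), fun i => ?_⟩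
    rw [hv, coeff_one]
    split_ifs <;> norm_num
  | mul a i ha hi ih =>
    intro h0 h
    obtain ⟨K, hK, hK'⟩ := ih ha (fun x hx h1 => h x hx (by simp [h1]))
    obtain ⟨L, hL, hL'⟩ := irred_case i hi (fun x hx h1 => h x hx (by simp [h1]))
    refine ⟨L * K, mul_ne_zero hL hK, fun j => ?_⟩
    have : i * a * (L * K) = (i * L) * (a * K) := by ring
    rw [this]
    exact nonneg_mul _ _ hL' hK' j

theorem stmt17 (F : Polynomial ℝ) (hF : F.Monic)
    (p : ℕ) (hp : p = Multiset.card (F.roots.filter (fun x => 0 < x))) :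
    ∃ K : Polynomial ℝ, K ≠ 0 ∧ signVar (F * K) = p := by
  set S := F.roots.filter (fun x => 0 < x) with hS
  have hSpos : ∀ b ∈ S, 0 < b := fun b hb => (Multiset.mem_filter.mp hb).2
  obtain ⟨q, hq, -, hq'⟩ := exists_prod_multiset_X_sub_C_mul F
  set T := F.roots.filter (fun x => ¬ 0 < x) with hT
  have hTpos : ∀ b ∈ T, ¬ 0 < b := fun b hb => (Multiset.mem_filter.mp hb).2
  rw [← Multiset.filter_add_not (fun x => 0 < x) F.roots, Multiset.map_add, Multiset.prod_add,
    ← hS, ← hT, mul_assoc] at hq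
  set P := (S.map (fun a => X - C a)).prod with hP
  set Q := (T.map (fun a => X - C a)).prod * q with hQ
  have hF0 : F ≠ 0 := hF.ne_zero
  have hQ0 : Q ≠ 0 := by
    intro h; rw [h, mul_zero] at hq; exact hF0 hq.symm
  have hq0 : q ≠ 0 := right_ne_zero_of_mul hQ0
  have hQx : ∀ x : ℝ, 0 < x → Q.eval x ≠ 0 := by
    intro x hx h
    rw [hQ, eval_mul, mul_eq_zero] at h
    rcases h with h | h
    · have : x ∈ ((T.map (fun a => X - C a)).prod).roots :=
        (mem_roots (left_ne_zero_of_mul hQ0)).mpr h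
      rw [roots_multiset_prod_X_sub_C] at this
      exact hTpos x this hx
    · have : x ∈ q.roots := (mem_roots hq0).mpr h
      rw [hq'] at this
      simp at this
  obtain ⟨K, hK, hK'⟩ := exists_nonneg Q hQ0 hQx
  set G := Q * K with hG
  have hG0 : G ≠ 0 := mul_ne_zero hQ0 hK
  set N := G.natDegree + 1 with hN
  set c := ((S.map (fun a => a ^ N)).map (fun a => X - C a)).prod with hc
  have hcm : c.Monic := monic_multiset_prod_of_monic _ _ (fun a _ => monic_X_sub_C a)
  have hcdeg : c.natDegree = p := by
    rw [hc, natDegree_multiset_prod_X_sub_C_eq_card, Multiset.card_map, hp]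
  have hdvd : P ∣ expand ℝ N c := by
    rw [hc, hP, map_multiset_prod, Multiset.map_map, Multiset.map_map]
    apply Multiset.prod_dvd_prod_of_dvd
    intro a _
    simp only [Function.comp, map_sub, expand_X, expand_C, map_pow]
    exact sub_dvd_pow_sub_pow _ _ _
  obtain ⟨R, hR⟩ := hdvd
  have hE : expand ℝ N c ≠ 0 := (expand_ne_zero (by omega)).mpr hcm.ne_zero
  have hR0 : R ≠ 0 := by
    intro h; rw [h, mul_zero] at hR; exact hE hR
  refine ⟨K * R, mul_ne_zero hK hR0, ?_⟩
  have hH : F * (K * R) = G * expand ℝ N c := by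
    rw [hR, hG, ← hq]; ring
  rw [hH]
  have halt := coeff_alt (S.map (fun a => a ^ N)) (by
    intro b hb
    obtain ⟨a, ha, rfl⟩ := Multiset.mem_map.mp hb
    exact pow_pos (hSpos a ha) N)
  rw [← hc, Multiset.card_map, ← hp] at halt
  rw [signVar_eq _ ((p + 1) * N), svAux_blocks N G.coeff hK' _ p c.coeff]
  · simp
  · intro k hk h
    have := halt k hk
    rw [h] at this
    simp at this
  · intro k hk
    have h1 := mul_pos (halt k hk.le) (halt (k + 1) hk)
    have e : (-1 : ℝ) ^ (k + p) * (-1 : ℝ) ^ (k + p) = 1 := by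
      rw [← mul_pow]; norm_num
    have e2 : (-1 : ℝ) ^ (k + p) * c.coeff k * ((-1) ^ (k + 1 + p) * c.coeff (k + 1)) =
        -(c.coeff k * c.coeff (k + 1)) := by
      rw [add_right_comm, pow_succ]
      linear_combination (-(c.coeff k * c.coeff (k + 1))) * e
    linarith
  · intro k _ j hj
    exact coeff_mul_expand G c N (by omega) k j hj
  · exact ⟨G.natDegree, by omega, leadingCoeff_ne_zero.mpr hG0⟩
  · rw [natDegree_mul hG0 hE, natDegree_expand, hcdeg, add_mul]
    omega
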